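/- arXiv:0811.3276 — 2 statements merged into one kernel-verified Lean document; each statement's English description precedes it below -/
import Mathlib

section
/- If X is a locally compact topological space, then each of the spaces F(X), F'(X), L(X), and L'(X), equipped with the lower semifinite topology τ_w, is locally compact (every point has a fundamental system of compact neighbourhoods). -/
open Filter Set Topology TopologicalSpace

universe u v

/-- The lower semifinite topology `τ_w` on the hyperspace `F(X)` of closed subsets of `X`:
it is generated by the base of all sets `U(∅,Φ)` with `Φ` a finite family of open sets. -/
def lowTop (X : Type u) [TopologicalSpace X] : TopologicalSpace (Closeds X) :=
  TopologicalSpace.generateFrom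
    {U | ∃ Φ : Finset (Set X), (∀ O ∈ Φ, IsOpen O) ∧
      U = {A : Closeds X | ∀ O ∈ Φ, ((A : Set X) ∩ O).Nonempty}}

/-- The Fell topology `τ_s` on the hyperspace `F(X)` of closed subsets of `X`:
it is generated by the base of all sets `U(C,Φ)` with `C` compact and `Φ` a finite
family of open sets. -/
def fellTop (X : Type u) [TopologicalSpace X] : TopologicalSpace (Closeds X) :=
  TopologicalSpace.generateFrom
    {U | ∃ (C : Set X) (Φ : Finset (Set X)), IsCompact C ∧ (∀ O ∈ Φ, IsOpen O) ∧
      U = {A : Closeds X | (A : Set X) ∩ C = ∅ ∧ ∀ O ∈ Φ, ((A : Set X) ∩ O).Nonempty}}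

/-- `L ⊆ X` is a limit set if there is a net (equivalently, a `NeBot` filter)
converging to every point of `L`. -/
def IsLimitSet {X : Type u} [TopologicalSpace X] (L : Set X) : Prop :=
  ∃ F : Filter X, F.NeBot ∧ ∀ x ∈ L, F ≤ nhds x

/-- A maximal limit set: a limit set maximal with respect to inclusion among all limit sets. -/
def IsMaxLimitSet {X : Type u} [TopologicalSpace X] (L : Set X) : Prop :=
  IsLimitSet L ∧ ∀ M : Set X, IsLimitSet M → L ⊆ M → M = L

/-- `L(X)`: the collection of all closed limit sets of `X`. -/
abbrev LX (X : Type u) [TopologicalSpace X] := {A : Closeds X // IsLimitSet (A : Set X)}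

/-- `ML(X)`: the collection of all maximal limit sets of `X` (each of these is closed). -/
abbrev MLX (X : Type u) [TopologicalSpace X] := {A : Closeds X // IsMaxLimitSet (A : Set X)}

/-- The subspace topology induced by `τ_w` on `L(X)`. -/
def lowTopL (X : Type u) [TopologicalSpace X] : TopologicalSpace (LX X) :=
  (lowTop X).induced Subtype.val

/-- The subspace topology induced by `τ_s` on `L(X)`. -/
def fellTopL (X : Type u) [TopologicalSpace X] : TopologicalSpace (LX X) :=
  (fellTop X).induced Subtype.val

/-- The subspace topology induced by `τ_w` on `ML(X)`. -/
def lowTopML (X : Type u) [TopologicalSpace X] : TopologicalSpace (MLX X) :=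
  (lowTop X).induced Subtype.val

/-- The subspace topology induced by `τ_s` on `ML(X)`. -/
def fellTopML (X : Type u) [TopologicalSpace X] : TopologicalSpace (MLX X) :=
  (fellTop X).induced Subtype.val

/-- A point `y` is separated in `Y` if every `z ∉ closure {y}` admits a neighbourhood
disjoint from some neighbourhood of `y`. -/
def IsSeparatedPt {Y : Type v} [TopologicalSpace Y] (y : Y) : Prop :=
  ∀ z : Y, z ∉ closure {y} → ∃ U ∈ nhds y, ∃ V ∈ nhds z, Disjoint U V

/-- The defining sets `U(∅,Φ)` form a base of the lower semifinite topology. -/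
theorem lowTop_isTopologicalBasis (X : Type u) [TopologicalSpace X] :
    @IsTopologicalBasis (Closeds X) (lowTop X)
      {U | ∃ Φ : Finset (Set X), (∀ O ∈ Φ, IsOpen O) ∧
        U = {A : Closeds X | ∀ O ∈ Φ, ((A : Set X) ∩ O).Nonempty}} := by
  classical
  let := lowTop X
  refine ⟨?_, ?_, rfl⟩
  · rintro _ ⟨Φ, hΦ, rfl⟩ _ ⟨Ψ, hΨ, rfl⟩ A ⟨hA, hA'⟩
    refine ⟨_, ⟨Φ ∪ Ψ, ?_, rfl⟩, ?_, ?_⟩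
    · intro O hO
      exact (Finset.mem_union.1 hO).elim (hΦ O) (hΨ O)
    · intro O hO
      exact (Finset.mem_union.1 hO).elim (hA O) (hA' O)
    · intro B hB
      exact ⟨fun O hO => hB O (Finset.mem_union_left _ hO),
        fun O hO => hB O (Finset.mem_union_right _ hO)⟩
  · refine eq_univ_of_forall fun A => ⟨_, ⟨∅, ?_, rfl⟩, ?_⟩ <;> simp

/-- The set of points all of whose open neighbourhoods are met by eventually all members of a
filter of closed sets. -/
def lowerLimit {X : Type u} [TopologicalSpace X] {Y : Type v} (s : Y → Closeds X)
    (f : Filter Y) : Closeds X where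
  carrier := {x | ∀ O, IsOpen O → x ∈ O → ∀ᶠ y in f, ((s y : Set X) ∩ O).Nonempty}
  isClosed' := by
    rw [← isOpen_compl_iff, isOpen_iff_forall_mem_open]
    intro x hx
    simp only [mem_compl_iff, mem_ofPred_eq, not_forall] at hx
    obtain ⟨O, hO, hxO, hf⟩ := hx
    exact ⟨O, fun y hy h => hf (h O hO hy), hO, hxO⟩

theorem tendsto_lowerLimit {X : Type u} [TopologicalSpace X] {Y : Type v} (s : Y → Closeds X)
    (f : Filter Y) : Tendsto s f (@nhds _ (lowTop X) (lowerLimit s f)) := by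
  refine tendsto_nhds_generateFrom_iff.2 ?_
  rintro _ ⟨Φ, hΦ, rfl⟩ h
  refine (eventually_all_finset Φ).2 fun O hO => ?_
  obtain ⟨x, hx, hxO⟩ := h O hO
  exact hx O (hΦ O hO) hxO

/-- If the members of an ultrafilter of closed sets meet a compact set, so does its limit. -/
theorem lowerLimit_inter_nonempty {X : Type u} [TopologicalSpace X] {Y : Type v}
    (s : Y → Closeds X) (f : Ultrafilter Y) {C : Set X} (hC : IsCompact C)
    (h : ∀ᶠ y in (f : Filter Y), ((s y : Set X) ∩ C).Nonempty) :
    ((lowerLimit s f : Set X) ∩ C).Nonempty := by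
  by_contra hne
  have key : ∀ᶠ y in (f : Filter Y), ¬ ((s y : Set X) ∩ C).Nonempty := by
    refine hC.induction_on (p := fun D => ∀ᶠ y in (f : Filter Y), ¬ ((s y : Set X) ∩ D).Nonempty)
      ?_ ?_ ?_ ?_
    · simp
    · intro D E hDE hE
      exact hE.mono fun y hy hD => hy (hD.mono (inter_subset_inter_right _ hDE))
    · intro D E hD hE
      filter_upwards [hD, hE] with y hyD hyE
      rw [inter_union_distrib_left, union_nonempty]
      tauto
    · intro x hx
      have hx' : x ∉ (lowerLimit s f : Set X) := fun h' => hne ⟨x, h', hx⟩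
      have hx'' : ¬ ∀ O, IsOpen O → x ∈ O → ∀ᶠ y in (f : Filter Y), ((s y : Set X) ∩ O).Nonempty :=
        hx'
      simp only [not_forall] at hx''
      obtain ⟨O, hO, hxO, hf⟩ := hx''
      refine ⟨O, mem_nhdsWithin_of_mem_nhds (hO.mem_nhds hxO), ?_⟩
      exact Ultrafilter.eventually_not.2 hf
  exact (h.and key).exists.elim fun y hy => hy.2 hy.1

/-- A limit of closed limit sets is a limit set. -/
theorem isLimitSet_lowerLimit {X : Type u} [TopologicalSpace X] {Y : Type v}
    (s : Y → Closeds X) (f : Filter Y) [f.NeBot] (h : ∀ y, IsLimitSet (s y : Set X)) :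
    IsLimitSet (lowerLimit s f : Set X) := by
  choose F hF hFs using h
  refine ⟨f.bind F, ⟨fun hbot => ?_⟩, fun x hx U hU => ?_⟩
  · obtain ⟨y, hy⟩ := Eventually.exists (mem_bind'.1 (empty_mem_iff_bot.2 hbot))
    exact (hF y).ne (empty_mem_iff_bot.1 hy)
  obtain ⟨O, hOU, hO, hxO⟩ := mem_nhds_iff.1 hU
  rw [mem_bind']
  filter_upwards [hx O hO hxO] with y ⟨z, hz, hzO⟩
  exact mem_of_superset (hFs y z hz (hO.mem_nhds hzO)) hOU

/-- A family of closed sets that is stable under limits of ultrafilters is locally compact in the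
lower semifinite topology. -/
theorem locallyCompactSpace_lowTop_induced {X : Type u} [TopologicalSpace X]
    [LocallyCompactSpace X] {Y : Type v} (s : Y → Closeds X)
    (hs : ∀ f : Ultrafilter Y, lowerLimit s f ∈ range s) :
    @LocallyCompactSpace Y ((lowTop X).induced s) := by
  classical
  let := lowTop X
  let : TopologicalSpace Y := (lowTop X).induced s
  refine ⟨fun A N hN => ?_⟩
  obtain ⟨M, hM, hMN⟩ := mem_nhds_induced s A N |>.1 hN
  obtain ⟨_, ⟨Φ, hΦ, rfl⟩, hA, hΦM⟩ := (lowTop_isTopologicalBasis X).mem_nhds_iff.1 hM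
  have hK : ∀ O : Set X, ∃ K : Set X, O ∈ Φ →
      IsCompact K ∧ K ⊆ O ∧ ((s A : Set X) ∩ interior K).Nonempty := by
    intro O
    by_cases hO : O ∈ Φ
    · obtain ⟨x, hxA, hxO⟩ := hA O hO
      obtain ⟨K, hK, hxK, hKO⟩ := exists_compact_subset (hΦ O hO) hxO
      exact ⟨K, fun _ => ⟨hK, hKO, x, hxA, hxK⟩⟩
    · exact ⟨∅, fun h => absurd h hO⟩
  choose K hK using hK
  refine ⟨{B | ∀ O ∈ Φ, ((s B : Set X) ∩ K O).Nonempty}, ?_, ?_, ?_⟩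
  · refine (mem_nhds_induced s A _).2
      ⟨{B | ∀ O ∈ Φ.image fun O => interior (K O), ((B : Set X) ∩ O).Nonempty}, ?_, ?_⟩
    · refine (lowTop_isTopologicalBasis X).mem_nhds ⟨_, ?_, rfl⟩ ?_
      · simp
      · simpa using fun O hO => (hK O hO).2.2
    · intro B hB O hO
      exact (hB _ (Finset.mem_image_of_mem _ hO)).mono
        (inter_subset_inter_right _ interior_subset)
  · intro B hB
    exact hMN (hΦM fun O hO => (hB O hO).mono (inter_subset_inter_right _ (hK O hO).2.1))
  · rw [isCompact_iff_ultrafilter_le_nhds]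
    intro f hf
    obtain ⟨B, hB⟩ := hs f
    refine ⟨B, fun O hO => ?_, ?_⟩
    · rw [hB]
      refine lowerLimit_inter_nonempty s f (hK O hO).1 ?_
      filter_upwards [le_principal_iff.1 hf] with y hy using hy O hO
    · rw [nhds_induced, ← tendsto_iff_comap, hB]
      exact tendsto_lowerLimit s f

/-- The nonempty members of a locally compact family of closed sets form a locally compact
space. -/
theorem locallyCompactSpace_lowTop_nonempty {X : Type u} [TopologicalSpace X] {Y Z : Type v}
    (s : Y → Closeds X) (hY : @LocallyCompactSpace Y ((lowTop X).induced s)) (i : Z → Y)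
    (hi : Function.Injective i) (hr : range i = {y | (s y : Set X).Nonempty}) :
    @LocallyCompactSpace Z ((lowTop X).induced (s ∘ i)) := by
  let := lowTop X
  let : TopologicalSpace Y := (lowTop X).induced s
  let : TopologicalSpace Z := (lowTop X).induced (s ∘ i)
  have hind : IsInducing i := ⟨induced_compose.symm⟩
  refine IsOpenEmbedding.locallyCompactSpace (f := i) ⟨⟨hind, hi⟩, ?_⟩
  rw [hr]
  refine isOpen_induced_iff.2 ⟨{A | (A : Set X).Nonempty}, ?_, rfl⟩
  refine (lowTop_isTopologicalBasis X).isOpen ⟨{univ}, ?_, ?_⟩ <;> simp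

/-- if `X` is locally compact then `F(X)`, `F'(X)`, `L(X)` and `L'(X)`
are locally compact in the topology `τ_w`. -/
theorem tauW_locallyCompact {X : Type u} [TopologicalSpace X] [LocallyCompactSpace X] :
    @LocallyCompactSpace (Closeds X) (lowTop X) ∧
    @LocallyCompactSpace {A : Closeds X // (A : Set X).Nonempty}
      ((lowTop X).induced Subtype.val) ∧
    @LocallyCompactSpace (LX X) (lowTopL X) ∧
    @LocallyCompactSpace {A : Closeds X // IsLimitSet (A : Set X) ∧ (A : Set X).Nonempty}
      ((lowTop X).induced Subtype.val) := by
  have hF : @LocallyCompactSpace (Closeds X) ((lowTop X).induced id) :=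
    locallyCompactSpace_lowTop_induced id fun _ => ⟨_, rfl⟩
  have hL : @LocallyCompactSpace (LX X) ((lowTop X).induced Subtype.val) :=
    locallyCompactSpace_lowTop_induced Subtype.val fun f =>
      ⟨⟨_, isLimitSet_lowerLimit Subtype.val f fun A : LX X => A.2⟩, rfl⟩
  refine ⟨by rwa [@induced_id _ (lowTop X)] at hF, ?_, hL, ?_⟩
  · exact locallyCompactSpace_lowTop_nonempty id hF Subtype.val Subtype.val_injective
      Subtype.range_val
  · refine locallyCompactSpace_lowTop_nonempty Subtype.val hL
      (fun A : {A : Closeds X // IsLimitSet (A : Set X) ∧ (A : Set X).Nonempty} => ⟨A.1, A.2.1⟩)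
      ?_ ?_
    · intro A B h
      exact Subtype.ext (congrArg (fun C : LX X => C.1) h)
    · ext A
      exact ⟨by rintro ⟨B, rfl⟩; exact B.2.2, fun h => ⟨⟨A.1, A.2, h⟩, rfl⟩⟩
end

section
/- If X is a Baire topological space, then ML(X), equipped with the subspace topology induced by the lower semifinite topology τ_w on F(X), is a Baire space. -/
open Filter Set Topology TopologicalSpace

universe u v

theorem isLimitSet_iff_neBot {X : Type u} [TopologicalSpace X] {L : Set X} :
    IsLimitSet L ↔ (⨅ x ∈ L, 𝓝 x).NeBot :=
  ⟨fun ⟨_, hF, h⟩ => hF.mono (le_iInf₂ h), fun h => ⟨_, h, fun _ hx => iInf₂_le _ hx⟩⟩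

theorem IsLimitSet.closure {X : Type u} [TopologicalSpace X] {L : Set X} (hL : IsLimitSet L) :
    IsLimitSet (closure L) := by
  obtain ⟨F, hF, h⟩ := hL
  refine ⟨F, hF, fun x hx => (nhds_basis_opens x).ge_iff.2 fun O hO => ?_⟩
  obtain ⟨y, hyO, hyL⟩ := mem_closure_iff.1 hx O hO.2 hO.1
  exact h y hyL (hO.2.mem_nhds hyO)

theorem IsLimitSet.sUnion {X : Type u} [TopologicalSpace X] {c : Set (Set X)}
    (hc : IsChain (· ⊆ ·) c) (hne : c.Nonempty) (h : ∀ s ∈ c, IsLimitSet s) :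
    IsLimitSet (⋃₀ c) := by
  rw [isLimitSet_iff_neBot, sUnion_eq_iUnion, iInf_iUnion]
  have : Nonempty c := hne.to_subtype
  refine iInf_neBot_of_directed' ?_ fun s => isLimitSet_iff_neBot.1 (h s s.2)
  intro s t
  rcases hc.total s.2 t.2 with hst | hts
  · exact ⟨t, biInf_mono hst, le_rfl⟩
  · exact ⟨s, le_rfl, biInf_mono hts⟩

theorem IsMaxLimitSet.nonempty {X : Type u} [TopologicalSpace X] {L : Set X}
    (hL : IsMaxLimitSet L) : L.Nonempty := by
  obtain ⟨F, hF, -⟩ := hL.1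
  obtain ⟨x⟩ := F.nonempty_of_neBot
  rw [nonempty_iff_ne_empty]
  rintro rfl
  exact singleton_ne_empty x (hL.2 {x} ⟨𝓝 x, inferInstance, by simp⟩ (empty_subset _))

/-- Every point lies in a (closed) maximal limit set. -/
theorem exists_mem_MLX {X : Type u} [TopologicalSpace X] (x : X) :
    ∃ L : MLX X, x ∈ (L.1 : Set X) := by
  obtain ⟨L, hxL, hL⟩ := zorn_subset_nonempty {L : Set X | IsLimitSet L}
    (fun c hcs hc hne => ⟨⋃₀ c, IsLimitSet.sUnion hc hne hcs, fun s hs => subset_sUnion_of_mem hs⟩)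
    {x} (show IsLimitSet {x} from ⟨𝓝 x, inferInstance, by simp⟩)
  have hmax : IsMaxLimitSet L :=
    ⟨hL.prop, fun M hM hLM => (hL.eq_of_subset hM hLM).symm⟩
  have hcl : IsClosed L :=
    closure_eq_iff_isClosed.1 (hmax.2 _ hmax.1.closure subset_closure)
  exact ⟨⟨⟨L, hcl⟩, hmax⟩, hxL rfl⟩

/-- If a filter converges to every point of `A`, then every `τ_w`-neighbourhood of `A` contains
all closed sets that meet some open member of the filter. -/
theorem exists_isOpen_mem_of_lowTop {X : Type u} [TopologicalSpace X] {A : Closeds X}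
    {F : Filter X} (hF : ∀ x ∈ (A : Set X), F ≤ 𝓝 x) {U : Set (Closeds X)}
    (hU : IsOpen[lowTop X] U) (hA : A ∈ U) :
    ∃ V ∈ F, IsOpen V ∧ ∀ B : Closeds X, ((B : Set X) ∩ V).Nonempty → B ∈ U := by
  induction hU with
  | basic U hU =>
    obtain ⟨Φ, hΦ, rfl⟩ := hU
    refine ⟨⋂ O ∈ Φ, O, (biInter_finset_mem Φ).2 fun O hO => ?_,
      isOpen_biInter_finset hΦ, ?_⟩
    · obtain ⟨x, hxA, hxO⟩ := hA O hO
      exact hF x hxA ((hΦ O hO).mem_nhds hxO)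
    · rintro B ⟨x, hxB, hx⟩ O hO
      exact ⟨x, hxB, mem_iInter₂.1 hx O hO⟩
  | univ => exact ⟨Set.univ, univ_mem, isOpen_univ, fun _ _ => trivial⟩
  | inter s t _ _ hs ht =>
    obtain ⟨V, hVF, hV, hVs⟩ := hs hA.1
    obtain ⟨W, hWF, hW, hWt⟩ := ht hA.2
    exact ⟨V ∩ W, inter_mem hVF hWF, hV.inter hW, fun B ⟨x, hxB, hxV, hxW⟩ =>
      ⟨hVs B ⟨x, hxB, hxV⟩, hWt B ⟨x, hxB, hxW⟩⟩⟩
  | sUnion S _ ih =>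
    obtain ⟨s, hs, hAs⟩ := hA
    obtain ⟨V, hVF, hV, hVs⟩ := ih s hs hAs
    exact ⟨V, hVF, hV, fun B hB => ⟨s, hs, hVs B hB⟩⟩

/-- The sets of maximal limit sets meeting a nonempty open set form a `π`-base of `ML(X)`;
the open set may be chosen inside any given open set that meets a member of `U`. -/
theorem exists_isOpen_subset_of_lowTopML {X : Type u} [TopologicalSpace X] {U : Set (MLX X)}
    (hU : IsOpen[lowTopML X] U) {L : MLX X} (hL : L ∈ U) {G : Set X} (hG : IsOpen G)
    (hLG : ((L.1 : Set X) ∩ G).Nonempty) :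
    ∃ V ⊆ G, V.Nonempty ∧ IsOpen V ∧
      ∀ M : MLX X, ((M.1 : Set X) ∩ V).Nonempty → M ∈ U := by
  obtain ⟨x, hxL, hxG⟩ := hLG
  obtain ⟨U', hU', rfl⟩ := hU
  obtain ⟨F, hF, hFL⟩ := L.2.1
  obtain ⟨V, hVF, hV, h⟩ := exists_isOpen_mem_of_lowTop hFL hU' hL
  exact ⟨V ∩ G, inter_subset_right,
    hF.nonempty_of_mem (inter_mem hVF (hFL x hxL (hG.mem_nhds hxG))), hV.inter hG,
    fun M hM => h M.1 (hM.mono (inter_subset_inter_right _ inter_subset_left))⟩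

theorem isOpen_lowTopML_setOf_meets {X : Type u} [TopologicalSpace X] {G : Set X}
    (hG : IsOpen G) : IsOpen[lowTopML X] {M : MLX X | ((M.1 : Set X) ∩ G).Nonempty} :=
  ⟨{A | ((A : Set X) ∩ G).Nonempty},
    isOpen_generateFrom_of_mem ⟨{G}, by simpa using hG, by simp⟩, rfl⟩

/-- The union of the open sets `V` such that every maximal limit set meeting `V` is in `W`. -/
def openTrace {X : Type u} [TopologicalSpace X] (W : Set (MLX X)) : Set X :=
  ⋃₀ {V | IsOpen V ∧ ∀ M : MLX X, ((M.1 : Set X) ∩ V).Nonempty → M ∈ W}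

theorem isOpen_openTrace {X : Type u} [TopologicalSpace X] (W : Set (MLX X)) :
    IsOpen (openTrace W) :=
  isOpen_sUnion fun _ hV => hV.1

theorem mem_of_mem_openTrace {X : Type u} [TopologicalSpace X] {W : Set (MLX X)} {x : X}
    (hx : x ∈ openTrace W) {M : MLX X} (hM : x ∈ (M.1 : Set X)) : M ∈ W := by
  obtain ⟨V, hV, hxV⟩ := hx
  exact hV.2 M ⟨x, hM, hxV⟩

theorem dense_openTrace {X : Type u} [TopologicalSpace X] {W : Set (MLX X)}
    (hW : IsOpen[lowTopML X] W) (hd : @Dense _ (lowTopML X) W) : Dense (openTrace W) := by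
  let := lowTopML X
  refine dense_iff_inter_open.2 fun G hG ⟨x, hx⟩ => ?_
  have hGo := isOpen_lowTopML_setOf_meets hG
  obtain ⟨L, hxL⟩ := exists_mem_MLX x
  obtain ⟨M, hMG, hMW⟩ := hd.inter_open_nonempty _ hGo ⟨L, x, hxL, hx⟩
  obtain ⟨V, hVG, ⟨y, hy⟩, hV⟩ := exists_isOpen_subset_of_lowTopML hW hMW hG hMG
  exact ⟨y, hVG hy, V, hV, hy⟩

/-- if `X` is a Baire space then `(ML(X), τ_w)` is a Baire space. -/
theorem ML_baire {X : Type u} [TopologicalSpace X] [BaireSpace X] :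
    @BaireSpace (MLX X) (lowTopML X) := by
  let := lowTopML X
  refine ⟨fun f ho hd => dense_iff_inter_open.2 fun U hU ⟨M, hM⟩ => ?_⟩
  obtain ⟨V, -, hVne, hV, hVU⟩ := exists_isOpen_subset_of_lowTopML hU hM isOpen_univ
    (by simpa using M.2.nonempty)
  obtain ⟨x, hxV, hx⟩ := (dense_iInter_of_isOpen_nat (fun n => isOpen_openTrace (f n))
    fun n => dense_openTrace (ho n) (hd n)).inter_open_nonempty V hV hVne
  obtain ⟨L, hxL⟩ := exists_mem_MLX x
  exact ⟨L, hVU L ⟨x, hxL, hxV⟩,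
    mem_iInter.2 fun n => mem_of_mem_openTrace (mem_iInter.1 hx n) hxL⟩
end
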